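/- The Gauss hypergeometric differential equation t(t−1)f″ + ((α+β+1)t − γ)f′ + αβ f = 0 with parameters α = 8/7, β = 3/7, γ = 9/7 is non-resonant (no difference of two of α, β, γ lies in ℤ), hence has irreducible monodromy, its local monodromies at 0 and 1 are of order 7 in the projective linear group, and by Schwarz's classification its monodromy group is infinite. -/

import Mathlib

open Polynomial

/-- `e2pi q = exp(2πi·q)`. -/
noncomputable def e2pi (q : ℚ) : ℂ := Complex.exp (2 * Real.pi * Complex.I * (q : ℂ))

/-- The `2×2` complex matrix `A` has characteristic polynomial `(X − a)(X − b)`,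
i.e. eigenvalues `a` and `b`. -/
def HasEigenvalues (A : Matrix (Fin 2) (Fin 2) ℂ) (a b : ℂ) : Prop :=
  A.charpoly = (X - C a) * (X - C b)

/-- `ρ`, viewed as a representation of `π₁(ℙ¹ \ {0,1,∞}) ≅ F₂` — the free group on the
two generators given by simple loops around `0` and `1`, so that the inverse of their
product is a simple loop around `∞` — is a monodromy representation of the Gauss
hypergeometric equation `t(t−1)f″ + ((α+β+1)t − γ)f′ + αβf = 0` with parameters
`α, β, γ` : its local monodromies have the eigenvalues prescribed by the Riemann
scheme, namely local exponents `(0, 1−γ)` at `0`, `(0, γ−α−β)` at `1` and `(α, β)`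
at `∞`. -/
def IsHypergeometricMonodromy (α β γ : ℚ)
    (ρ : FreeGroup (Fin 2) →* Matrix.GeneralLinearGroup (Fin 2) ℂ) : Prop :=
  HasEigenvalues ((ρ (FreeGroup.of 0) : Matrix (Fin 2) (Fin 2) ℂ)) 1 (e2pi (1 - γ)) ∧
  HasEigenvalues ((ρ (FreeGroup.of 1) : Matrix (Fin 2) (Fin 2) ℂ)) 1 (e2pi (γ - α - β)) ∧
  HasEigenvalues
    (((ρ (FreeGroup.of 0) * ρ (FreeGroup.of 1))⁻¹ : Matrix.GeneralLinearGroup (Fin 2) ℂ) :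
      Matrix (Fin 2) (Fin 2) ℂ)
    (e2pi α) (e2pi β)

/-- The representation `ρ` is irreducible: `ℂ²` has no nontrivial `ρ`-invariant
subspace. -/
def IsIrreducibleRep (ρ : FreeGroup (Fin 2) →* Matrix.GeneralLinearGroup (Fin 2) ℂ) : Prop :=
  ∀ W : Submodule ℂ (Fin 2 → ℂ),
    (∀ g : FreeGroup (Fin 2),
      W.map (Matrix.mulVecLin ((ρ g : Matrix (Fin 2) (Fin 2) ℂ))) ≤ W) →
    W = ⊥ ∨ W = ⊤

/-- The image of an element of `GL(2, ℂ)` in the projective linear group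
`PGL(2, ℂ) = GL(2, ℂ)/center`. -/
def toPGL2 (g : Matrix.GeneralLinearGroup (Fin 2) ℂ) :
    Matrix.GeneralLinearGroup (Fin 2) ℂ ⧸ Subgroup.center (Matrix.GeneralLinearGroup (Fin 2) ℂ) :=
  QuotientGroup.mk' (Subgroup.center (Matrix.GeneralLinearGroup (Fin 2) ℂ)) g

/-- `e2pi q` is the `k`-th power of `exp(2πi/7)` when `q ≡ k/7` modulo `ℤ`. -/
lemma e2pi_eq_exp_pow {q : ℚ} (k : ℕ) (m : ℤ) (h : q = k / 7 + m) :
    e2pi q = Complex.exp (2 * Real.pi * Complex.I / (7 : ℕ)) ^ k := by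
  rw [e2pi, ← Complex.exp_nat_mul, Complex.exp_eq_exp_iff_exists_int]
  refine ⟨m, ?_⟩
  rw [h]
  push_cast
  ring

lemma HasEigenvalues.trace_eq {A : Matrix (Fin 2) (Fin 2) ℂ} {a b : ℂ}
    (h : HasEigenvalues A a b) : A.trace = a + b := by
  rw [HasEigenvalues, Matrix.charpoly_fin_two] at h
  have h0 := congrArg (eval 0) h
  have h1 := congrArg (eval 1) h
  simp at h0 h1
  linear_combination h0 - h1

lemma HasEigenvalues.det_eq {A : Matrix (Fin 2) (Fin 2) ℂ} {a b : ℂ}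
    (h : HasEigenvalues A a b) : A.det = a * b := by
  rw [HasEigenvalues, Matrix.charpoly_fin_two] at h
  simpa using congrArg (eval 0) h

lemma HasEigenvalues.eq_or_eq {A : Matrix (Fin 2) (Fin 2) ℂ} {a b c : ℂ}
    (h : HasEigenvalues A a b) {v : Fin 2 → ℂ} (hv : v ≠ 0) (hc : A.mulVec v = c • v) :
    c = a ∨ c = b := by
  have h0 : A.charpoly.eval c = 0 := by
    rw [Matrix.eval_charpoly, ← Matrix.exists_mulVec_eq_zero_iff]
    refine ⟨v, hv, ?_⟩
    rw [Matrix.sub_mulVec, hc, Matrix.scalar_apply, Matrix.diagonal_const_mulVec, sub_self]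
  rw [HasEigenvalues] at h
  rw [h] at h0
  simpa [sub_eq_zero] using h0

/-- A matrix with distinct `n`-th roots of unity as eigenvalues has order dividing `n`. -/
lemma HasEigenvalues.pow_eq_one {A : Matrix (Fin 2) (Fin 2) ℂ} {a b : ℂ}
    (h : HasEigenvalues A a b) (hab : a ≠ b) {n : ℕ} (ha : a ^ n = 1) (hb : b ^ n = 1) :
    A ^ n = 1 := by
  have hdvd : (X - C a) * (X - C b) ∣ (X ^ n - 1 : ℂ[X]) := by
    refine IsCoprime.mul_dvd (isCoprime_X_sub_C_of_isUnit_sub (sub_ne_zero.2 hab).isUnit) ?_ ?_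
    · simp [dvd_iff_isRoot, ha]
    · simp [dvd_iff_isRoot, hb]
  rw [← h] at hdvd
  obtain ⟨q, hq⟩ := hdvd
  have := congrArg (aeval A) hq
  rw [map_mul, Matrix.aeval_self_charpoly, zero_mul] at this
  simpa [sub_eq_zero] using this

/-- A matrix with two distinct eigenvalues is not central. -/
lemma HasEigenvalues.notMem_center {g : Matrix.GeneralLinearGroup (Fin 2) ℂ} {a b : ℂ}
    (h : HasEigenvalues (g : Matrix (Fin 2) (Fin 2) ℂ) a b) (hab : a ≠ b) :
    g ∉ Subgroup.center (Matrix.GeneralLinearGroup (Fin 2) ℂ) := by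
  intro hg
  rw [Matrix.GeneralLinearGroup.mem_center_iff_val_mem_range_scalar] at hg
  obtain ⟨c, hc⟩ := hg
  have ht := h.trace_eq
  have hd := h.det_eq
  rw [← hc] at ht hd
  simp only [Matrix.det_fin_two, Matrix.trace_fin_two, Matrix.scalar_apply,
    Matrix.diagonal_apply_eq, Fin.isValue, ne_eq, zero_ne_one, one_ne_zero, not_false_eq_true,
    Matrix.diagonal_apply_ne, mul_zero, sub_zero] at ht hd
  apply hab
  have : (a - b) ^ 2 = 0 := by linear_combination (-(a + b) - 2 * c) * ht + 4 * hd
  simpa [sub_eq_zero] using this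

lemma HasEigenvalues.orderOf_toPGL2 {g : Matrix.GeneralLinearGroup (Fin 2) ℂ} {a b : ℂ} {p : ℕ}
    (hp : p.Prime) (h : HasEigenvalues (g : Matrix (Fin 2) (Fin 2) ℂ) a b) (hab : a ≠ b)
    (ha : a ^ p = 1) (hb : b ^ p = 1) : orderOf (toPGL2 g) = p := by
  have := Fact.mk hp
  refine orderOf_eq_prime ?_ ?_
  · have hg : g ^ p = 1 := Units.ext (by simpa using h.pow_eq_one hab ha hb)
    rw [toPGL2, ← map_pow, hg, map_one]
  · intro h1
    exact h.notMem_center hab ((QuotientGroup.eq_one_iff g).1 h1)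

lemma trace_inv_mul_det (g : Matrix.GeneralLinearGroup (Fin 2) ℂ) :
    (↑g⁻¹ : Matrix (Fin 2) (Fin 2) ℂ).trace * (g : Matrix (Fin 2) (Fin 2) ℂ).det =
      (g : Matrix (Fin 2) (Fin 2) ℂ).trace := by
  have hd : (g : Matrix (Fin 2) (Fin 2) ℂ).det ≠ 0 := g.det_ne_zero
  rw [Matrix.coe_units_inv, Matrix.inv_def, Matrix.trace_smul, Ring.inverse_eq_inv', smul_eq_mul,
    mul_right_comm, inv_mul_cancel₀ hd, Matrix.adjugate_fin_two, Matrix.trace_fin_two,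
    Matrix.trace_fin_two]
  simp [add_comm]

lemma trace_mul_inv_mul_det (g h : Matrix.GeneralLinearGroup (Fin 2) ℂ) :
    (↑(g * h⁻¹) : Matrix (Fin 2) (Fin 2) ℂ).trace * (h : Matrix (Fin 2) (Fin 2) ℂ).det =
      (g : Matrix (Fin 2) (Fin 2) ℂ).trace * (h : Matrix (Fin 2) (Fin 2) ℂ).trace -
        (↑(g * h) : Matrix (Fin 2) (Fin 2) ℂ).trace := by
  have hd : (h : Matrix (Fin 2) (Fin 2) ℂ).det ≠ 0 := h.det_ne_zero
  rw [Units.val_mul, Units.val_mul, Matrix.coe_units_inv, Matrix.inv_def, Matrix.mul_smul,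
    Matrix.trace_smul, Ring.inverse_eq_inv', smul_eq_mul, mul_right_comm, inv_mul_cancel₀ hd,
    Matrix.adjugate_fin_two]
  simp [Matrix.trace_fin_two, Matrix.mul_apply, Fin.sum_univ_two]
  ring

/-- Powers of a matrix of determinant one have traces given by Dickson polynomials. -/
lemma trace_pow_eq_eval_dickson {M : Matrix (Fin 2) (Fin 2) ℂ} (hM : M.det = 1) (n : ℕ) :
    (M ^ n).trace = aeval M.trace (dickson 1 (1 : ℚ) n) := by
  have hCH : M ^ 2 = M.trace • M - 1 := by
    have := Matrix.aeval_self_charpoly M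
    rw [Matrix.charpoly_fin_two, hM] at this
    simp only [map_add, map_sub, map_mul, map_pow, aeval_X, map_one, aeval_C,
      Algebra.algebraMap_eq_smul_one, smul_mul_assoc, one_mul] at this
    rw [← sub_eq_zero, ← this]
    abel
  induction n using Nat.twoStepInduction with
  | zero =>
    simp [map_ofNat]
    norm_num
  | one => simp
  | more n h0 h1 =>
    rw [dickson_add_two, pow_add, hCH, mul_sub, mul_one, mul_smul_comm, ← pow_succ,
      Matrix.trace_sub, Matrix.trace_smul, h0, h1]
    simp

lemma two_lt_eval_dickson {s : ℝ} (hs : 2 < s) {n : ℕ} (hn : 0 < n) :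
    2 < aeval s (dickson 1 (1 : ℚ) n) := by
  have key (n : ℕ) : 2 ≤ aeval s (dickson 1 (1 : ℚ) n) ∧
      aeval s (dickson 1 (1 : ℚ) n) < aeval s (dickson 1 (1 : ℚ) (n + 1)) := by
    induction n with
    | zero =>
      simp [map_ofNat]
      constructor <;> linarith
    | succ n ih =>
      refine ⟨by linarith, ?_⟩
      rw [dickson_add_two]
      simp only [map_sub, map_mul, aeval_X, map_one, one_mul]
      nlinarith
  obtain ⟨m, rfl⟩ := Nat.exists_eq_succ_of_ne_zero hn.ne'
  exact (key m).1.trans_lt (key m).2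

/-- The minimal polynomial of `2 + 2 cos (4π/7) - 2 cos (2π/7)`. -/
noncomputable def traceCubic : ℚ[X] := X ^ 3 - 6 * X ^ 2 + 5 * X - 1

lemma traceCubic_natDegree : traceCubic.natDegree = 3 := by
  unfold traceCubic
  compute_degree!

lemma traceCubic_monic : traceCubic.Monic := by
  unfold traceCubic
  monicity!

lemma traceCubic_irreducible : Irreducible traceCubic := by
  refine irreducible_of_degree_le_three_of_not_isRoot
    (by rw [traceCubic_natDegree]; decide) fun x hx => ?_
  have hx' : x ^ 3 - 6 * x ^ 2 + 5 * x - 1 = 0 := by simpa [traceCubic] using hx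
  have hint : IsIntegral ℤ x := by
    refine ⟨X ^ 3 - 6 * X ^ 2 + 5 * X - 1, by monicity!, ?_⟩
    simpa using hx'
  obtain ⟨m, rfl⟩ := IsIntegrallyClosed.isIntegral_iff.1 hint
  have hm : m ^ 3 - 6 * m ^ 2 + 5 * m - 1 = 0 := by
    simp only [eq_intCast] at hx'
    exact_mod_cast hx'
  have hu : m * (m ^ 2 - 6 * m + 5) = 1 := by linear_combination hm
  rcases Int.eq_one_or_neg_one_of_mul_eq_one hu with rfl | rfl <;> norm_num at hm

lemma exists_two_lt_aeval_traceCubic_eq_zero : ∃ s : ℝ, 2 < s ∧ aeval s traceCubic = 0 := by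
  have hcont : ContinuousOn (fun s : ℝ => s ^ 3 - 6 * s ^ 2 + 5 * s - 1) (Set.Icc 2 6) := by
    fun_prop
  obtain ⟨s, hs, h0⟩ := intermediate_value_Ioo (by norm_num) hcont
    (show (0 : ℝ) ∈ Set.Ioo _ _ by norm_num)
  exact ⟨s, hs.1, by simpa [traceCubic, map_ofNat] using h0⟩

/-- A matrix of determinant one whose trace is a root of `traceCubic` has infinite order: its
trace has a real conjugate larger than `2`. -/
lemma pow_ne_one_of_aeval_trace_eq_zero {M : Matrix (Fin 2) (Fin 2) ℂ} (hdet : M.det = 1)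
    (htr : aeval M.trace traceCubic = 0) {n : ℕ} (hn : 0 < n) : M ^ n ≠ 1 := by
  intro h1
  have h2 : aeval M.trace (dickson 1 (1 : ℚ) n - 2) = 0 := by
    rw [map_sub, ← trace_pow_eq_eval_dickson hdet, h1]
    simp [map_ofNat]
  have hdvd := minpoly.dvd ℚ _ h2
  rw [← minpoly.eq_of_irreducible_of_monic traceCubic_irreducible htr traceCubic_monic] at hdvd
  obtain ⟨s, hs, hs0⟩ := exists_two_lt_aeval_traceCubic_eq_zero
  have h3 := aeval_eq_zero_of_dvd_aeval_eq_zero hdvd hs0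
  have h4 := two_lt_eval_dickson hs hn
  rw [map_sub, sub_eq_zero, map_ofNat] at h3
  exact h4.ne' h3

lemma infinite_range_of_pow_ne_one {G H : Type*} [Group G] [Group H] (ρ : G →* H) (g : G)
    (h : ∀ n : ℕ, 0 < n → ρ g ^ n ≠ 1) : (Set.range ρ).Infinite := by
  intro hfin
  have : Finite ρ.range := hfin
  obtain ⟨n, hn, h1⟩ := (isOfFinOrder_of_finite (ρ.rangeRestrict g)).exists_pow_eq_one
  exact h n hn (by simpa using congrArg Subtype.val h1)

/-- A representation of `F₂` on `ℂ²` is irreducible if no product of eigenvalues of the images of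
the three loops is `1`. -/
lemma isIrreducibleRep_of_mul_ne_one
    (ρ : FreeGroup (Fin 2) →* Matrix.GeneralLinearGroup (Fin 2) ℂ) {x y : ℂ × ℂ} {z : ℂ × ℂ}
    (hx : HasEigenvalues (ρ (FreeGroup.of 0) : Matrix (Fin 2) (Fin 2) ℂ) x.1 x.2)
    (hy : HasEigenvalues (ρ (FreeGroup.of 1) : Matrix (Fin 2) (Fin 2) ℂ) y.1 y.2)
    (hz : HasEigenvalues (((ρ (FreeGroup.of 0) * ρ (FreeGroup.of 1))⁻¹ :
      Matrix.GeneralLinearGroup (Fin 2) ℂ) : Matrix (Fin 2) (Fin 2) ℂ) z.1 z.2)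
    (h : ∀ a b c : ℂ, (a = x.1 ∨ a = x.2) → (b = y.1 ∨ b = y.2) → (c = z.1 ∨ c = z.2) →
      c * (a * b) ≠ 1) : IsIrreducibleRep ρ := by
  intro W hW
  by_contra! hne
  have hlt := Submodule.finrank_lt hne.2
  have hpos : 0 < Module.finrank ℂ W :=
    Nat.pos_of_ne_zero fun h0 => hne.1 (Submodule.finrank_eq_zero.1 h0)
  have hone : Module.finrank ℂ W = 1 := by
    rw [Module.finrank_fin_fun] at hlt
    omega
  obtain ⟨⟨v, hvW⟩, hv0, hspan⟩ := finrank_eq_one_iff'.1 hone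
  have hv : v ≠ 0 := fun h0 => hv0 (Subtype.ext h0)
  have heig (g : FreeGroup (Fin 2)) :
      ∃ c : ℂ, (ρ g : Matrix (Fin 2) (Fin 2) ℂ).mulVec v = c • v := by
    obtain ⟨c, hc⟩ := hspan ⟨_, hW g ⟨v, hvW, rfl⟩⟩
    exact ⟨c, (congrArg Subtype.val hc).symm⟩
  obtain ⟨a, ha⟩ := heig (FreeGroup.of 0)
  obtain ⟨b, hb⟩ := heig (FreeGroup.of 1)
  obtain ⟨c, hc⟩ := heig (FreeGroup.of 0 * FreeGroup.of 1)⁻¹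
  rw [map_inv, map_mul] at hc
  refine h a b c (hx.eq_or_eq hv ha) (hy.eq_or_eq hv hb) (hz.eq_or_eq hv hc) ?_
  have hprod : (c * (a * b)) • v = (1 : ℂ) • v := by
    calc (c * (a * b)) • v
        = (((ρ (FreeGroup.of 0) * ρ (FreeGroup.of 1))⁻¹ * (ρ (FreeGroup.of 0) *
            ρ (FreeGroup.of 1)) : Matrix.GeneralLinearGroup (Fin 2) ℂ) :
              Matrix (Fin 2) (Fin 2) ℂ).mulVec v := by
          rw [Units.val_mul, Units.val_mul, ← Matrix.mulVec_mulVec, ← Matrix.mulVec_mulVec, hb,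
            Matrix.mulVec_smul, ha, Matrix.mulVec_smul, Matrix.mulVec_smul, hc, smul_smul,
            smul_smul]
          ring_nf
      _ = (1 : ℂ) • v := by rw [inv_mul_cancel, Units.val_one, Matrix.one_mulVec, one_smul]
  exact smul_left_injective ℂ hv hprod

/-- The Gauss hypergeometric differential equation
`t(t−1)f″ + ((α+β+1)t − γ)f′ + αβf = 0` with parameters `α = 8/7`, `β = 3/7`,
`γ = 9/7` is non-resonant (no difference of two of `α, β, γ` lies in `ℤ`), hence has
irreducible monodromy, its local monodromies at `0` and `1` are of order `7` in the
projective linear group, and (by Schwarz's classification) its monodromy group is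
infinite. -/
theorem hypergeometric_8_3_9_sevenths_infinite_monodromy :
    ((∀ n : ℤ, (8 : ℚ) / 7 - 3 / 7 ≠ (n : ℚ)) ∧
     (∀ n : ℤ, (8 : ℚ) / 7 - 9 / 7 ≠ (n : ℚ)) ∧
     (∀ n : ℤ, (3 : ℚ) / 7 - 9 / 7 ≠ (n : ℚ))) ∧
    ∀ ρ : FreeGroup (Fin 2) →* Matrix.GeneralLinearGroup (Fin 2) ℂ,
      IsHypergeometricMonodromy (8 / 7) (3 / 7) (9 / 7) ρ →
        IsIrreducibleRep ρ ∧
        orderOf (toPGL2 (ρ (FreeGroup.of 0))) = 7 ∧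
        orderOf (toPGL2 (ρ (FreeGroup.of 1))) = 7 ∧
        (Set.range ⇑ρ).Infinite := by
  refine ⟨⟨fun n h => ?_, fun n h => ?_, fun n h => ?_⟩, fun ρ hρ => ?_⟩
  · have : (5 : ℚ) = ((7 * n : ℤ) : ℚ) := by push_cast; linarith
    have : 5 = 7 * n := by exact_mod_cast this
    omega
  · have : (-1 : ℚ) = ((7 * n : ℤ) : ℚ) := by push_cast; linarith
    have : -1 = 7 * n := by exact_mod_cast this
    omega
  · have : (-6 : ℚ) = ((7 * n : ℤ) : ℚ) := by push_cast; linarith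
    have : -6 = 7 * n := by exact_mod_cast this
    omega
  obtain ⟨hA, hB, hAB⟩ := hρ
  rw [e2pi_eq_exp_pow 5 (-1) (by norm_num)] at hA hB
  rw [e2pi_eq_exp_pow (q := 8 / 7) 1 1 (by norm_num),
    e2pi_eq_exp_pow (q := 3 / 7) 3 0 (by norm_num)] at hAB
  have hζ := Complex.isPrimitiveRoot_exp 7 (by norm_num)
  set ζ := Complex.exp (2 * Real.pi * Complex.I / (7 : ℕ))
  have hζ7 : ζ ^ 7 = 1 := hζ.pow_eq_one
  have hζpow {k : ℕ} (hk : ¬ 7 ∣ k) : ζ ^ k ≠ 1 := fun h => hk (hζ.dvd_of_pow_eq_one k h)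
  have h1 : 1 ≠ ζ ^ 5 := (hζpow (by norm_num)).symm
  have h5 : (ζ ^ 5) ^ 7 = 1 := by rw [pow_right_comm, hζ7, one_pow]
  refine ⟨isIrreducibleRep_of_mul_ne_one ρ (x := (1, ζ ^ 5)) (y := (1, ζ ^ 5))
      (z := (ζ ^ 1, ζ ^ 3)) hA hB hAB ?_,
    hA.orderOf_toPGL2 (by norm_num) h1 (one_pow 7) h5,
    hB.orderOf_toPGL2 (by norm_num) h1 (one_pow 7) h5,
    infinite_range_of_pow_ne_one ρ (FreeGroup.of 0 * (FreeGroup.of 1)⁻¹) fun n hn h => ?_⟩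
  · rintro a b c (rfl | rfl) (rfl | rfl) (rfl | rfl) <;>
      simp only [← pow_add, mul_one, one_mul] <;> exact hζpow (by norm_num)
  rw [map_mul, map_inv] at h
  set A := ρ (FreeGroup.of 0)
  set B := ρ (FreeGroup.of 1)
  have hdetA := hA.det_eq
  have hdetB := hB.det_eq
  rw [one_mul] at hdetA hdetB
  have hdet : (↑(A * B⁻¹) : Matrix (Fin 2) (Fin 2) ℂ).det = 1 := by
    have hBB : (↑(A * B⁻¹ * B) : Matrix (Fin 2) (Fin 2) ℂ).det = ζ ^ 5 := by
      rw [inv_mul_cancel_right, hdetA]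
    rw [Units.val_mul, Matrix.det_mul, hdetB] at hBB
    exact mul_right_cancel₀ (pow_ne_zero 5 (hζ.ne_zero (by norm_num))) (by rw [hBB, one_mul])
  refine pow_ne_one_of_aeval_trace_eq_zero hdet ?_ hn
    (by rw [← Units.val_pow_eq_pow_val, h, Units.val_one])
  have htAB := trace_inv_mul_det (A * B)
  rw [hAB.trace_eq, Units.val_mul, Matrix.det_mul, hdetA, hdetB, ← Units.val_mul] at htAB
  have htr := trace_mul_inv_mul_det A B
  rw [← htAB, hA.trace_eq, hB.trace_eq, hdetB] at htr
  have hgeom : 1 + ζ + ζ ^ 2 + ζ ^ 3 + ζ ^ 4 + ζ ^ 5 + ζ ^ 6 = 0 := by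
    simpa [Finset.sum_range_succ] using hζ.geom_sum_eq_zero (by norm_num)
  have ht : (↑(A * B⁻¹) : Matrix (Fin 2) (Fin 2) ℂ).trace = 2 + ζ ^ 2 + ζ ^ 5 - ζ - ζ ^ 6 := by
    refine mul_right_cancel₀ (pow_ne_zero 5 (hζ.ne_zero (by norm_num))) ?_
    rw [htr]
    linear_combination (-1 - ζ ^ 6) * hζ7
  rw [ht]
  simp only [traceCubic, map_sub, map_add, map_mul, map_pow, aeval_X, map_one, map_ofNat]
  linear_combination (-7 + 14 * ζ - 14 * ζ ^ 2 + 6 * ζ ^ 3 + 4 * ζ ^ 4 - 13 * ζ ^ 5 + 18 * ζ ^ 6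
    - 12 * ζ ^ 7 + 2 * ζ ^ 8 + 4 * ζ ^ 9 - 6 * ζ ^ 10 + 4 * ζ ^ 11 - ζ ^ 12) * hgeom
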